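/- For every instance I in the support of the recursively-defined hard distribution 𝓘(C, μ, n) (with n odd, m = (n−1)/2, gap parameter C ∈ (0,1/4)), the complexity satisfies H^⟨m⟩(I) = Θ(C^{−2}·n·ln(e + ln n / ln K)). In particular there exist universal constants c₁, c₂ > 0 such that c₁·C^{−2}·n·ln(e + ln n/ln K) ≤ H^⟨m⟩(I) ≤ c₂·C^{−2}·n·ln(e + ln n/ln K) for sufficiently large n. -/

import Mathlib

/-- `r`-th largest value (1-indexed) of a multiset of mean rewards. -/
noncomputable def kthM (M : Multiset ℝ) (r : ℕ) : ℝ :=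
  (M.sort (· ≥ ·)).getD (r - 1) 0

/-- Gap of an arm with mean `x` w.r.t. pivot `t` in the instance `M`. -/
noncomputable def gapM (M : Multiset ℝ) (t : ℕ) (x : ℝ) : ℝ :=
  if kthM M t ≤ x then x - kthM M (t + 1) else kthM M t - x

/-- Instance complexity `H^⟨t⟩(M) = Σ_{x∈M} (Δ_x^⟨t⟩(M))⁻²`. -/
noncomputable def HM (M : Multiset ℝ) (t : ℕ) : ℝ :=
  (M.map fun x => ((gapM M t x) ^ 2)⁻¹).sum

/-- The support of the recursively defined hard distribution `𝓘(C, μ, n)`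
(for `K` agents), described as a multiset of mean rewards. -/
inductive InSupport (K : ℕ) : ℝ → ℝ → ℕ → Multiset ℝ → Prop
  | base (C μ : ℝ) (n : ℕ) (hn : n ≤ K ^ 10) :
      InSupport K C μ n
        (Multiset.replicate ((n - 1) / 2) (μ + C / 2) +
          Multiset.replicate ((n - 1) / 2) (μ - C / 2) + {μ})
  | step (C μ : ℝ) (n η : ℕ) (hn : K ^ 10 < n)
      -- `η` is the smallest odd integer greater than `n^{1/4}`
      (hηodd : Odd η) (hηgt : (n : ℝ) ^ ((1 : ℝ) / 4) < η)
      (hηmin : ∀ η' : ℕ, Odd η' → (n : ℝ) ^ ((1 : ℝ) / 4) < (η' : ℝ) → η ≤ η')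
      -- the bias `ξ`
      (ξ : ℤ) (hξ1 : -(η : ℤ) ≤ ξ) (hξ2 : ξ ≤ (η : ℤ))
      -- numbers of top and bottom arms
      (t b : ℕ)
      (htb1 : (t : ℤ) + (b : ℤ) = (n : ℤ) - (η : ℤ) * (2 * (η : ℤ) + 1))
      (htb2 : (t : ℤ) - (b : ℤ) = 2 * ξ * (η : ℤ))
      -- the middle blocks, recursively from the hard distribution
      (blocks : Fin (2 * η + 1) → Multiset ℝ)
      (hblocks : ∀ j : Fin (2 * η + 1),
        InSupport K (C * Real.sqrt ((η : ℝ) / n))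
          (μ + ((j : ℝ) - η) / 8 * C * (n : ℝ) ^ (-(1 : ℝ) / 4)) η (blocks j)) :
      InSupport K C μ n
        (Multiset.replicate t (μ + C / 2) + Multiset.replicate b (μ - C / 2) +
          ∑ j, blocks j)

lemma kth_mid (A B Z : Multiset ℝ) (hAB : ∀ a ∈ A, ∀ b ∈ B, b ≤ a)
    (hAZ : ∀ a ∈ A, ∀ z ∈ Z, z ≤ a) (hBZ : ∀ b ∈ B, ∀ z ∈ Z, z ≤ b)
    (r : ℕ) (h1 : 1 ≤ r) (h2 : r ≤ Multiset.card B) :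
    kthM (A + B + Z) (Multiset.card A + r) = kthM B r := by
  have hs : (A + B + Z).sort (· ≥ ·)
      = A.sort (· ≥ ·) ++ (B.sort (· ≥ ·) ++ Z.sort (· ≥ ·)) := by
    refine List.Perm.eq_of_pairwise' (r := (· ≥ ·)) (Multiset.pairwise_sort _ _) ?_ ?_
    · rw [List.pairwise_append, List.pairwise_append]
      refine ⟨Multiset.pairwise_sort _ _, ⟨Multiset.pairwise_sort _ _,
        Multiset.pairwise_sort _ _, ?_⟩, ?_⟩
      · intro a ha b hb
        exact hBZ a (by simpa using ha) b (by simpa using hb)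
      · intro a ha b hb
        rw [List.mem_append] at hb
        rcases hb with hb | hb
        · exact hAB a (by simpa using ha) b (by simpa using hb)
        · exact hAZ a (by simpa using ha) b (by simpa using hb)
    · rw [← Multiset.coe_eq_coe, ← Multiset.coe_add, ← Multiset.coe_add]
      simp only [Multiset.sort_eq]
      rw [add_assoc]
  unfold kthM
  rw [hs, List.getD_append_right _ _ _ _ (by simp; omega), List.getD_append _ _ _ _ (by simp; omega)]
  congr 1
  simp
  omega

lemma kth_mem (M : Multiset ℝ) (r : ℕ) (h0 : 0 < Multiset.card M) (h2 : r ≤ Multiset.card M) :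
    kthM M r ∈ M := by
  unfold kthM
  have h : r - 1 < (M.sort (· ≥ ·)).length := by simp; omega
  rw [List.getD_eq_getElem _ _ h]
  have := List.getElem_mem h
  exact (Multiset.mem_sort (· ≥ ·)).1 this

lemma gap_sq (M : Multiset ℝ) (t : ℕ) (x : ℝ) :
    gapM M t x ^ 2 = (x - kthM M t) ^ 2 ∨ gapM M t x ^ 2 = (x - kthM M (t + 1)) ^ 2 := by
  unfold gapM
  split_ifs
  · right; rfl
  · left; ring

lemma HM_nonneg (M : Multiset ℝ) (t : ℕ) : 0 ≤ HM M t := by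
  unfold HM
  apply Multiset.sum_nonneg
  intro x hx
  rw [Multiset.mem_map] at hx
  obtain ⟨a, _, rfl⟩ := hx
  positivity

lemma step_num (n η : ℕ) (hn : 1024 < n)
    (hηodd : Odd η) (hηgt : (n : ℝ) ^ ((1 : ℝ) / 4) < η)
    (hηmin : ∀ η' : ℕ, Odd η' → (n : ℝ) ^ ((1 : ℝ) / 4) < (η' : ℝ) → η ≤ η') :
    ∃ s : ℝ, 5 ≤ s ∧ s ^ 4 = n ∧ s < η ∧ (η : ℝ) ≤ s + 2 ∧ (n : ℝ) ^ (-(1 : ℝ) / 4) = s⁻¹ := by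
  have hn' : (1024 : ℝ) < n := by exact_mod_cast hn
  have h4 : ((n : ℝ) ^ ((1 : ℝ) / 4)) ^ 4 = n := by
    rw [← Real.rpow_natCast, ← Real.rpow_mul (by positivity)]
    norm_num
  have h0 : 0 ≤ (n : ℝ) ^ ((1 : ℝ) / 4) := by positivity
  refine ⟨(n : ℝ) ^ ((1 : ℝ) / 4), ?_, h4, hηgt, ?_, ?_⟩
  · by_contra h
    push Not at h
    have := pow_lt_pow_left₀ h h0 (n := 4) (by norm_num)
    rw [h4] at this
    linarith
  · by_contra h
    push Not at h
    have h2 : 2 < η := by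
      have : (2 : ℝ) < η := by linarith
      exact_mod_cast this
    have h3 := hηmin (η - 2) (by
      obtain ⟨k, hk⟩ := hηodd
      exact ⟨k - 1, by omega⟩) (by
      rw [Nat.cast_sub h2.le]; push_cast; linarith)
    omega
  · rw [← Real.rpow_neg (by positivity)]
    congr 1
    norm_num

/-- The scale `√(η/n)` in terms of `s = n^{1/4}`. -/
lemma scale_small (s η n : ℝ) (hs : 5 ≤ s) (hsn : s ^ 4 = n) (h1 : s < η) (h2 : η ≤ s + 2) :
    0 < Real.sqrt (η / n) ∧ Real.sqrt (η / n) ≤ 1 / 8 := by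
  have hn : 0 < n := by rw [← hsn]; positivity
  refine ⟨Real.sqrt_pos.2 (by apply div_pos <;> linarith), ?_⟩
  rw [Real.sqrt_le_left (by norm_num), div_le_iff₀ hn, ← hsn]
  nlinarith [pow_le_pow_left₀ (by norm_num) hs 3, pow_le_pow_left₀ (by norm_num) hs 2]

lemma scale_tiny (s η n : ℝ) (hs : 400 ≤ s) (hsn : s ^ 4 = n) (h1 : s < η) (h2 : η ≤ s + 2) :
    Real.sqrt (η / n) ≤ s⁻¹ / 16 := by
  have hn : 0 < n := by rw [← hsn]; positivity
  have hs0 : 0 < s := by linarith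
  rw [Real.sqrt_le_left (by positivity), div_le_iff₀ hn, ← hsn]
  have : (s⁻¹ / 16) ^ 2 * s ^ 4 = s ^ 2 / 256 := by field_simp; norm_num
  rw [this]
  nlinarith

lemma offset_bound (s η j C : ℝ) (hs : 5 ≤ s) (h1 : s < η) (h2 : η ≤ s + 2) (hC : 0 ≤ C)
    (hj0 : 0 ≤ j) (hj : j ≤ 2 * η) :
    |(j - η) / 8 * C * s⁻¹| ≤ C * (7 / 40) := by
  have hs0 : 0 < s := by linarith
  have e : (j - η) / 8 * C * s⁻¹ = C * ((j - η) / (8 * s)) := by field_simp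
  rw [e, abs_mul, abs_of_nonneg hC]
  apply mul_le_mul_of_nonneg_left _ hC
  rw [abs_div, abs_of_pos (by positivity : 0 < 8 * s), div_le_iff₀ (by positivity), abs_le]
  constructor <;> linarith

lemma supp_facts (K : ℕ) (hK : 2 ≤ K) (C μ : ℝ) (n : ℕ) (M : Multiset ℝ)
    (h : InSupport K C μ n M) (hn : Odd n) (hC : 0 ≤ C) :
    Multiset.card M = n ∧ ∀ x ∈ M, |x - μ| ≤ C / 2 := by
  induction h with
  | base C μ n hnK =>
    constructor
    · obtain ⟨k, rfl⟩ := hn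
      simp
      omega
    · intro x hx
      simp only [Multiset.mem_add, Multiset.mem_singleton] at hx
      rcases hx with (hx | hx) | hx
      · rw [Multiset.eq_of_mem_replicate hx, abs_le]; constructor <;> linarith
      · rw [Multiset.eq_of_mem_replicate hx, abs_le]; constructor <;> linarith
      · rw [hx, abs_le]; constructor <;> linarith
  | step C μ n η hnK hηodd hηgt hηmin ξ hξ1 hξ2 t b htb1 htb2 blocks hblocks ih =>
    have hn' : 1024 < n := lt_of_le_of_lt (by
      calc 1024 = 2 ^ 10 := by norm_num
        _ ≤ K ^ 10 := Nat.pow_le_pow_left hK 10) hnK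
    obtain ⟨s, hs5, hsn, hs1, hs2, hsi⟩ := step_num n η hn' hηodd hηgt hηmin
    obtain ⟨hq0, hq⟩ := scale_small s η n hs5 hsn hs1 hs2
    have ih' := fun j => ih j hηodd (by positivity)
    constructor
    · simp only [Multiset.card_add, Multiset.card_replicate, Multiset.card_sum]
      rw [Finset.sum_congr rfl (fun j _ => (ih' j).1)]
      simp
      zify
      linarith
    · intro x hx
      simp only [Multiset.mem_add] at hx
      rcases hx with (hx | hx) | hx
      · rw [Multiset.eq_of_mem_replicate hx, abs_le]; constructor <;> linarith
      · rw [Multiset.eq_of_mem_replicate hx, abs_le]; constructor <;> linarith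
      · rw [Multiset.mem_sum] at hx
        obtain ⟨j, _, hj⟩ := hx
        have h1 := (ih' j).2 x hj
        have hj2 : ((j : ℕ) : ℝ) ≤ 2 * η := by
          have := j.2
          exact_mod_cast (by omega : (j : ℕ) ≤ 2 * η)
        have h2 := offset_bound s η j C hs5 hs1 hs2 hC (by positivity) hj2
        rw [hsi] at h1
        rw [abs_le] at *
        have h3 := mul_le_mul_of_nonneg_left hq hC
        constructor <;> linarith [h1.1, h1.2, h2.1, h2.2]

/-- Up to the affine map, only finitely many means are possible for each `n`. -/
lemma supp_finite (K : ℕ) (hK : 2 ≤ K) (n : ℕ) :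
    ∃ D : Set ℝ, D.Finite ∧ ∀ (C μ : ℝ) (M : Multiset ℝ), InSupport K C μ n M →
      ∀ x ∈ M, ∃ d ∈ D, x = μ + C * d := by
  induction n using Nat.strong_induction_on with
  | _ n IH =>
    choose! D hDf hD using IH
    refine ⟨{1 / 2, -1 / 2, 0} ∪ ⋃ η ∈ Set.Iio n, ⋃ j ∈ Set.Iio (2 * η + 1),
      (fun d : ℝ => ((j : ℕ) - (η : ℝ)) / 8 * (n : ℝ) ^ (-(1 : ℝ) / 4)
        + Real.sqrt ((η : ℝ) / n) * d) '' D η, ?_, ?_⟩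
    · refine Set.Finite.union (by simp) ?_
      refine Set.Finite.biUnion (Set.finite_Iio n) fun η hη => ?_
      refine Set.Finite.biUnion (Set.finite_Iio _) fun j hj => ?_
      exact (hDf η hη).image _
    · intro C μ M h x hx
      cases h with
      | base _ _ _ hnK =>
        simp only [Multiset.mem_add, Multiset.mem_singleton] at hx
        rcases hx with (hx | hx) | hx
        · exact ⟨1 / 2, by simp, by rw [Multiset.eq_of_mem_replicate hx]; ring⟩
        · exact ⟨-1 / 2, by simp, by rw [Multiset.eq_of_mem_replicate hx]; ring⟩
        · exact ⟨0, by simp, by rw [hx]; ring⟩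
      | step _ _ _ η hnK hηodd hηgt hηmin ξ hξ1 hξ2 t b htb1 htb2 blocks hblocks =>
        have hn' : 1024 < n := lt_of_le_of_lt (by
          calc 1024 = 2 ^ 10 := by norm_num
            _ ≤ K ^ 10 := Nat.pow_le_pow_left hK 10) hnK
        obtain ⟨s, hs5, hsn, hs1, hs2, hsi⟩ := step_num n η hn' hηodd hηgt hηmin
        have hηn : η < n := by
          have : (η : ℝ) < n := by
            rw [← hsn]
            nlinarith [pow_le_pow_left₀ (by norm_num) hs5 3]
          exact_mod_cast this
        simp only [Multiset.mem_add] at hx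
        rcases hx with (hx | hx) | hx
        · exact ⟨1 / 2, by simp, by rw [Multiset.eq_of_mem_replicate hx]; ring⟩
        · exact ⟨-1 / 2, by simp, by rw [Multiset.eq_of_mem_replicate hx]; ring⟩
        · rw [Multiset.mem_sum] at hx
          obtain ⟨j, _, hj⟩ := hx
          obtain ⟨d, hd, hxd⟩ := hD η hηn _ _ _ (hblocks j) x hj
          refine ⟨_, Or.inr (Set.mem_biUnion (show η ∈ Set.Iio n from hηn)
            (Set.mem_biUnion (show (j : ℕ) ∈ Set.Iio (2 * η + 1) from j.2) ⟨d, hd, rfl⟩)), ?_⟩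
          rw [hxd]
          ring

/-- A lower bound on nonzero differences in a finite set. -/
lemma finite_gap (D : Set ℝ) (hD : D.Finite) :
    ∃ e : ℝ, 0 < e ∧ ∀ x ∈ D, ∀ y ∈ D, x = y ∨ e ≤ (x - y) ^ 2 := by
  have hF : ((fun p : ℝ × ℝ => (p.1 - p.2) ^ 2) '' (D ×ˢ D) \ {0}).Finite :=
    ((hD.prod hD).image _).sdiff
  by_cases hne : ((fun p : ℝ × ℝ => (p.1 - p.2) ^ 2) '' (D ×ˢ D) \ {0}).Nonempty
  · obtain ⟨e, ⟨⟨p, hp, rfl⟩, he0⟩, hmin⟩ := Set.exists_min_image _ id hF hne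
    refine ⟨_, lt_of_le_of_ne (sq_nonneg (p.1 - p.2)) (fun h => he0 h.symm), ?_⟩
    intro x hx y hy
    by_cases hxy : x = y
    · exact Or.inl hxy
    · right
      exact hmin ((x - y) ^ 2) ⟨⟨(x, y), ⟨hx, hy⟩, rfl⟩, by
        simpa [sub_eq_zero] using hxy⟩
  · refine ⟨1, one_pos, ?_⟩
    intro x hx y hy
    by_cases hxy : x = y
    · exact Or.inl hxy
    · exact absurd ⟨(x - y) ^ 2, ⟨⟨(x, y), ⟨hx, hy⟩, rfl⟩, by
        simpa [sub_eq_zero] using hxy⟩⟩ hne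

/-- Crude bound for fixed `n`. -/
lemma small_bound_one (K : ℕ) (hK : 2 ≤ K) (n : ℕ) :
    ∃ B : ℝ, 0 ≤ B ∧ (Odd n → ∀ (C μ : ℝ) (M : Multiset ℝ), 0 < C → InSupport K C μ n M →
      HM M ((n - 1) / 2) ≤ B * (C ^ 2)⁻¹) := by
  obtain ⟨D, hDf, hD⟩ := supp_finite K hK n
  obtain ⟨e, he, hgap⟩ := finite_gap D hDf
  refine ⟨n * e⁻¹, by positivity, ?_⟩
  intro hn C μ M hC h
  obtain ⟨hcard, -⟩ := supp_facts K hK C μ n M h hn hC.le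
  have hpos : 0 < n := hn.pos
  have key : ∀ x ∈ M, ∀ y ∈ M, ((x - y) ^ 2)⁻¹ ≤ e⁻¹ * (C ^ 2)⁻¹ := by
    intro x hx y hy
    obtain ⟨d, hd, rfl⟩ := hD C μ M h x hx
    obtain ⟨d', hd', rfl⟩ := hD C μ M h y hy
    rcases hgap d hd d' hd' with h1 | h1
    · rw [h1]; simp; positivity
    · rw [← mul_inv]
      apply inv_anti₀ (by positivity)
      have : (μ + C * d - (μ + C * d')) ^ 2 = (d - d') ^ 2 * C ^ 2 := by ring
      rw [this]
      gcongr
  unfold HM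
  have : (M.map fun x => ((gapM M ((n - 1) / 2) x) ^ 2)⁻¹).sum
      ≤ (M.map fun _ => e⁻¹ * (C ^ 2)⁻¹).sum := by
    apply Multiset.sum_map_le_sum_map
    intro x hx
    rcases gap_sq M ((n - 1) / 2) x with h1 | h1 <;> rw [h1]
    · exact key x hx _ (kth_mem M _ (by omega) (by omega))
    · exact key x hx _ (kth_mem M _ (by omega) (by omega))
  refine this.trans (le_of_eq ?_)
  simp [hcard]
  ring

lemma small_bound (K : ℕ) (hK : 2 ≤ K) (T : ℕ) :
    ∃ B : ℝ, 0 ≤ B ∧ ∀ n, n ≤ T → Odd n → ∀ (C μ : ℝ) (M : Multiset ℝ), 0 < C →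
      InSupport K C μ n M → HM M ((n - 1) / 2) ≤ B * (C ^ 2)⁻¹ := by
  choose B hB0 hB using small_bound_one K hK
  refine ⟨∑ i ∈ Finset.range (T + 1), B i, Finset.sum_nonneg fun i _ => hB0 i, ?_⟩
  intro n hn hodd C μ M hC h
  refine (hB n hodd C μ M hC h).trans ?_
  gcongr
  exact Finset.single_le_sum (f := B) (fun i _ => hB0 i) (by simp; omega)

lemma sum_map_sum {ι : Type*} (S : Finset ι) (f : ι → Multiset ℝ) (g : ℝ → ℝ) :
    ((∑ j ∈ S, f j).map g).sum = ∑ j ∈ S, ((f j).map g).sum := by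
  classical
  induction S using Finset.induction_on with
  | empty => simp
  | insert a S ha ih => rw [Finset.sum_insert ha, Finset.sum_insert ha, Multiset.map_add,
      Multiset.sum_add, ih]

lemma fin_split {A : Type*} [AddCommMonoid A] (N : ℕ) (f : Fin N → A) (j0 : Fin N) :
    ∑ j, f j = ∑ j ∈ Finset.Ioi j0, f j + (f j0 + ∑ j ∈ Finset.Iio j0, f j) := by
  classical
  rw [← Finset.sum_filter_add_sum_filter_not Finset.univ (fun j => j0 < j)]
  have e1 : Finset.univ.filter (fun j => j0 < j) = Finset.Ioi j0 := by ext; simp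
  have e2 : Finset.univ.filter (fun j => ¬ j0 < j) = insert j0 (Finset.Iio j0) := by
    ext j; simp [le_iff_eq_or_lt]
  rw [e1, e2, Finset.sum_insert (by simp)]

lemma sum_map_le_card (M : Multiset ℝ) (g : ℝ → ℝ) (c : ℝ) (h : ∀ x ∈ M, g x ≤ c) :
    (M.map g).sum ≤ Multiset.card M * c := by
  have : (M.map g).sum ≤ (M.map fun _ => c).sum := Multiset.sum_map_le_sum_map _ _ h
  simpa using this

lemma sq_aux1 (δ x p : ℝ) (hδ : 0 < δ) (h : x + δ / 2 ≤ p) : (δ / 2) ^ 2 ≤ (x - p) ^ 2 := by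
  nlinarith

lemma sq_aux2 (δ x p : ℝ) (hδ : 0 < δ) (h : p + δ / 2 ≤ x) : (δ / 2) ^ 2 ≤ (x - p) ^ 2 := by
  nlinarith

set_option maxHeartbeats 2000000 in
lemma step_main (K : ℕ) (hK : 2 ≤ K) (C μ : ℝ) (n : ℕ) (M : Multiset ℝ) (hnK : K ^ 10 < n)
    (hbig : 400 ^ 4 < n) (hn : Odd n) (hC : 0 < C) (h : InSupport K C μ n M) :
    ∃ (η : ℕ) (s C' μ' : ℝ) (M' : Multiset ℝ), Odd η ∧ 400 ≤ s ∧ s ^ 4 = n ∧ s < η ∧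
      (η : ℝ) ≤ s + 2 ∧ 0 < C' ∧ (η : ℝ) * (C' ^ 2)⁻¹ = n * (C ^ 2)⁻¹ ∧
      InSupport K C' μ' η M' ∧
      HM M' ((η - 1) / 2) + n / 2 * (C ^ 2)⁻¹ ≤ HM M ((n - 1) / 2) ∧
      HM M ((n - 1) / 2) ≤ HM M' ((η - 1) / 2) + 1040 * n * (C ^ 2)⁻¹ := by
  cases h with
  | base _ _ _ hnK' => omega
  | step _ _ _ η hnK' hηodd hηgt hηmin ξ hξ1 hξ2 t b htb1 htb2 blocks hblocks =>
    obtain ⟨s, hs5, hsn, hs1, hs2, hsi⟩ := step_num n η (by omega) hηodd hηgt hηmin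
    have hs400 : 400 ≤ s := by
      by_contra hlt
      push Not at hlt
      have h1 := pow_lt_pow_left₀ hlt (by linarith) (n := 4) (by norm_num)
      rw [hsn] at h1
      have h2 : ((400 ^ 4 : ℕ) : ℝ) < n := by exact_mod_cast hbig
      push_cast at h2
      linarith
    have hs0 : 0 < s := by linarith
    have hnpos : (0 : ℝ) < n := by rw [← hsn]; positivity
    have hηpos : (0 : ℝ) < η := by linarith
    obtain ⟨hq0, hq⟩ := scale_small s η n hs5 hsn hs1 hs2
    have hqt := scale_tiny s η n hs400 hsn hs1 hs2
    rw [hsi] at hblocks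
    set q := Real.sqrt ((η : ℝ) / n) with hqdef
    have hq2 : q ^ 2 = η / n := Real.sq_sqrt (by positivity)
    have hCq : 0 < C * q := by positivity
    -- facts about blocks
    have hfacts := fun j => supp_facts K hK _ _ η (blocks j) (hblocks j) hηodd hCq.le
    obtain ⟨δ, hδ⟩ : ∃ δ : ℝ, δ = C * s⁻¹ / 8 := ⟨_, rfl⟩
    have hδ0 : 0 < δ := by rw [hδ]; positivity
    have hCqδ : C * q / 2 ≤ δ / 4 := by
      have := mul_le_mul_of_nonneg_left hqt hC.le
      rw [hδ]; linarith
    have hloc : ∀ j, ∀ x ∈ blocks j, |x - (μ + (((j : ℕ) : ℝ) - η) * δ)| ≤ δ / 4 := by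
      intro j x hx
      have h1 := ((hfacts j).2 x hx).trans hCqδ
      have e : (((j : ℕ) : ℝ) - η) / 8 * C * s⁻¹ = (((j : ℕ) : ℝ) - η) * δ := by rw [hδ]; ring
      rwa [e] at h1
    have hμ : ∀ j, ∀ x ∈ blocks j, |x - μ| ≤ C / 4 := by
      intro j x hx
      have h1 := (hfacts j).2 x hx
      have hj2 : ((j : ℕ) : ℝ) ≤ 2 * η := by
        have := j.2
        exact_mod_cast (by omega : (j : ℕ) ≤ 2 * η)
      have h2 := offset_bound s η j C hs5 hs1 hs2 hC.le (by positivity) hj2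
      have h3 := mul_le_mul_of_nonneg_left hq hC.le
      rw [abs_le] at *
      constructor <;> linarith [h1.1, h1.2, h2.1, h2.2]
    have hord : ∀ j j' : Fin (2 * η + 1), j < j' → ∀ x ∈ blocks j, ∀ y ∈ blocks j',
        x + δ / 2 ≤ y := by
      intro j j' hjj x hx y hy
      have h1 := hloc j x hx
      have h2 := hloc j' y hy
      have h3 : ((j : ℕ) : ℝ) + 1 ≤ ((j' : ℕ) : ℝ) := by exact_mod_cast hjj
      have h4 := mul_le_mul_of_nonneg_right h3 hδ0.le
      rw [abs_le] at *
      linarith [h1.1, h1.2, h2.1, h2.2]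
    -- pivot block
    obtain ⟨j0, hj0⟩ : ∃ j0 : Fin (2 * η + 1), ((j0 : ℕ) : ℤ) = η + ξ :=
      ⟨⟨(η + ξ).toNat, by omega⟩, by simp; omega⟩
    set A := Multiset.replicate t (μ + C / 2) + ∑ j ∈ Finset.Ioi j0, blocks j with hA
    set Z := Multiset.replicate b (μ - C / 2) + ∑ j ∈ Finset.Iio j0, blocks j with hZ
    set B := blocks j0 with hB
    set M := Multiset.replicate t (μ + C / 2) + Multiset.replicate b (μ - C / 2) +
          ∑ j, blocks j with hMdef
    have hM : M = A + B + Z := by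
      rw [hMdef, fin_split _ _ j0, hA, hZ]
      abel
    have hcB : Multiset.card B = η := (hfacts j0).1
    have hcA : Multiset.card A = t + (2 * η - j0) * η := by
      rw [hA, Multiset.card_add, Multiset.card_replicate, Multiset.card_sum,
        Finset.sum_congr rfl (fun j _ => (hfacts j).1)]
      simp
    have hη3 : 3 ≤ η := by
      have : (3 : ℝ) ≤ η := by linarith
      exact_mod_cast this
    have hm : (n - 1) / 2 = Multiset.card A + (η - 1) / 2 := by
      rw [hcA]
      obtain ⟨k, rfl⟩ := hηodd
      obtain ⟨l, rfl⟩ := hn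
      have hj2 := j0.2
      have e1 : (2 * l + 1 - 1) / 2 = l := by omega
      have e2 : (2 * k + 1 - 1) / 2 = k := by omega
      rw [e1, e2]
      zify [show (j0 : ℕ) ≤ 2 * (2 * k + 1) by omega]
      rw [hj0]
      push_cast at *
      linarith
    have hmemA : ∀ x ∈ A, x = μ + C / 2 ∨ ∃ j, j0 < j ∧ x ∈ blocks j := by
      intro x hx
      rw [hA, Multiset.mem_add, Multiset.mem_sum] at hx
      rcases hx with hx | ⟨j, hj, hx⟩
      · exact Or.inl (Multiset.eq_of_mem_replicate hx)
      · exact Or.inr ⟨j, by simpa using hj, hx⟩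
    have hmemZ : ∀ x ∈ Z, x = μ - C / 2 ∨ ∃ j, j < j0 ∧ x ∈ blocks j := by
      intro x hx
      rw [hZ, Multiset.mem_add, Multiset.mem_sum] at hx
      rcases hx with hx | ⟨j, hj, hx⟩
      · exact Or.inl (Multiset.eq_of_mem_replicate hx)
      · exact Or.inr ⟨j, by simpa using hj, hx⟩
    have hAB : ∀ a ∈ A, ∀ y ∈ B, y ≤ a := by
      intro a ha y hy
      rcases hmemA a ha with rfl | ⟨j, hj, hx⟩
      · have := hμ j0 y hy
        rw [abs_le] at this
        linarith [this.2]
      · have := hord j0 j hj y hy a hx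
        linarith
    have hBZ : ∀ y ∈ B, ∀ z ∈ Z, z ≤ y := by
      intro y hy z hz
      rcases hmemZ z hz with rfl | ⟨j, hj, hx⟩
      · have := hμ j0 y hy
        rw [abs_le] at this
        linarith [this.1]
      · have := hord j j0 hj z hx y hy
        linarith
    obtain ⟨y0, hy0⟩ : ∃ y, y ∈ B := Multiset.card_pos_iff_exists_mem.1 (by omega)
    have hAZ : ∀ a ∈ A, ∀ z ∈ Z, z ≤ a := fun a ha z hz =>
      (hBZ y0 hy0 z hz).trans (hAB a ha y0 hy0)
    have hk1 : kthM M ((n - 1) / 2) = kthM B ((η - 1) / 2) := by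
      rw [hm, hM]
      exact kth_mid A B Z hAB hAZ hBZ _ (by omega) (by omega)
    have hk2 : kthM M ((n - 1) / 2 + 1) = kthM B ((η - 1) / 2 + 1) := by
      rw [hm, hM, add_assoc (Multiset.card A)]
      exact kth_mid A B Z hAB hAZ hBZ _ (by omega) (by omega)
    have hgB : ∀ x, gapM M ((n - 1) / 2) x = gapM B ((η - 1) / 2) x := by
      intro x
      unfold gapM
      rw [hk1, hk2]
    have hgap : ∀ x, ∃ p ∈ B, gapM M ((n - 1) / 2) x ^ 2 = (x - p) ^ 2 := by
      intro x
      rw [hgB]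
      rcases gap_sq B ((η - 1) / 2) x with h1 | h1
      · exact ⟨_, kth_mem B _ (by omega) (by omega), h1⟩
      · exact ⟨_, kth_mem B _ (by omega) (by omega), h1⟩
    obtain ⟨g, hg⟩ : ∃ g : ℝ → ℝ, g = fun x => ((gapM M ((n - 1) / 2) x) ^ 2)⁻¹ := ⟨_, rfl⟩
    have hg0 : ∀ x, 0 ≤ g x := by intro x; rw [hg]; positivity
    have hHM : HM M ((n - 1) / 2) = t * g (μ + C / 2) + b * g (μ - C / 2)
        + HM B ((η - 1) / 2) + (∑ j ∈ Finset.Ioi j0, ((blocks j).map g).sum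
          + ∑ j ∈ Finset.Iio j0, ((blocks j).map g).sum) := by
      have e : HM B ((η - 1) / 2) = (B.map g).sum := by
        unfold HM
        rw [hg]
        simp only [hgB]
      rw [e]
      unfold HM
      rw [← hg]
      conv_lhs => rw [hM, hA, hZ]
      simp only [Multiset.map_add, Multiset.sum_add, sum_map_sum, Multiset.map_replicate,
        Multiset.sum_replicate, nsmul_eq_mul]
      ring
    have hfar : ∀ x, |x - μ| = C / 2 → (C ^ 2)⁻¹ ≤ g x ∧ g x ≤ 16 * (C ^ 2)⁻¹ := by
      intro x hx
      obtain ⟨p, hp, hpe⟩ := hgap x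
      have h1 := hμ j0 p hp
      have h2 : |x - p| ≤ C := by
        have := abs_sub_le x μ p
        rw [abs_sub_comm μ p] at this
        linarith
      have h3 : C / 4 ≤ |x - p| := by
        have := abs_sub_le x p μ
        linarith
      rw [hg]
      simp only [hpe]
      rw [← sq_abs (x - p)]
      constructor
      · apply inv_anti₀
        · have : 0 < |x - p| := by linarith
          positivity
        · exact pow_le_pow_left₀ (abs_nonneg _) h2 2
      · have e : 16 * (C ^ 2)⁻¹ = ((C / 4) ^ 2)⁻¹ := by field_simp; norm_num
        rw [e]
        apply inv_anti₀ (by positivity)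
        exact pow_le_pow_left₀ (by positivity) h3 2
    have htop := hfar (μ + C / 2) (by simp; linarith)
    have hbot := hfar (μ - C / 2) (by
      rw [show μ - C / 2 - μ = -(C / 2) by ring, abs_neg, abs_of_pos (by positivity)])
    have hnear : ∀ j, j ≠ j0 → ((blocks j).map g).sum ≤ η * (256 * s ^ 2 * (C ^ 2)⁻¹) := by
      intro j hj
      rw [← (hfacts j).1]
      apply sum_map_le_card
      intro x hx
      obtain ⟨p, hp, hpe⟩ := hgap x
      have h1 : (δ / 2) ^ 2 ≤ (x - p) ^ 2 := by
        rcases lt_or_gt_of_ne hj with hlt | hlt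
        · have := hord j j0 hlt x hx p hp
          exact sq_aux1 δ x p hδ0 this
        · have := hord j0 j hlt p hp x hx
          exact sq_aux2 δ x p hδ0 this
      have e : 256 * s ^ 2 * (C ^ 2)⁻¹ = ((δ / 2) ^ 2)⁻¹ := by
        rw [hδ]; field_simp; norm_num
      rw [hg]
      simp only [hpe]
      rw [e]
      exact inv_anti₀ (by positivity) h1
    have hrest0 : 0 ≤ ∑ j ∈ Finset.Ioi j0, ((blocks j).map g).sum
          + ∑ j ∈ Finset.Iio j0, ((blocks j).map g).sum := by
      have : ∀ j, 0 ≤ ((blocks j).map g).sum := by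
        intro j
        apply Multiset.sum_nonneg
        intro x hx
        rw [Multiset.mem_map] at hx
        obtain ⟨a, _, rfl⟩ := hx
        exact hg0 a
      exact add_nonneg (Finset.sum_nonneg fun j _ => this j) (Finset.sum_nonneg fun j _ => this j)
    have hrest : ∑ j ∈ Finset.Ioi j0, ((blocks j).map g).sum
          + ∑ j ∈ Finset.Iio j0, ((blocks j).map g).sum
          ≤ (2 * η) * (η * (256 * s ^ 2 * (C ^ 2)⁻¹)) := by
      have h1 := Finset.sum_le_card_nsmul (Finset.Ioi j0) (fun j => ((blocks j).map g).sum) _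
        (fun j hj => hnear j (by simp at hj; exact hj.ne'))
      have h2 := Finset.sum_le_card_nsmul (Finset.Iio j0) (fun j => ((blocks j).map g).sum) _
        (fun j hj => hnear j (by simp at hj; exact hj.ne))
      rw [nsmul_eq_mul] at h1 h2
      have h3 : ((Finset.Ioi j0).card : ℝ) + ((Finset.Iio j0).card : ℝ) = 2 * η := by
        have := j0.2
        have : (Finset.Ioi j0).card + (Finset.Iio j0).card = 2 * η := by
          simp; omega
        exact_mod_cast this
      rw [← h3, add_mul]
      exact add_le_add h1 h2
    have htbR : (t : ℝ) + b = n - η * (2 * η + 1) := by exact_mod_cast htb1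
    have hCi : 0 < (C ^ 2)⁻¹ := by positivity
    have hη2 : (η : ℝ) ^ 2 ≤ 2 * s ^ 2 := by nlinarith
    have hη2s : (η : ℝ) ^ 2 * s ^ 2 ≤ 2 * n := by
      rw [← hsn]
      have := mul_le_mul_of_nonneg_right hη2 (sq_nonneg s)
      nlinarith
    refine ⟨η, s, C * q, _, B, hηodd, hs400, hsn, hs1, hs2, hCq, ?_, hblocks j0, ?_, ?_⟩
    · rw [mul_pow, hq2]
      field_simp
    · rw [hHM]
      have h1 := mul_le_mul_of_nonneg_left htop.1 (Nat.cast_nonneg (α := ℝ) t)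
      have h2 := mul_le_mul_of_nonneg_left hbot.1 (Nat.cast_nonneg (α := ℝ) b)
      have h3 : (n : ℝ) / 2 ≤ t + b := by
        rw [htbR]
        have : (160000 : ℝ) * s ^ 2 ≤ n := by
          rw [← hsn]; nlinarith [mul_le_mul_of_nonneg_right
            (by nlinarith : (160000 : ℝ) ≤ s ^ 2) (sq_nonneg s)]
        nlinarith
      have h4 := mul_le_mul_of_nonneg_right h3 hCi.le
      nlinarith
    · rw [hHM]
      have h1 := mul_le_mul_of_nonneg_left htop.2 (Nat.cast_nonneg (α := ℝ) t)
      have h2 := mul_le_mul_of_nonneg_left hbot.2 (Nat.cast_nonneg (α := ℝ) b)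
      have h3 : (t : ℝ) + b ≤ n := by
        rw [htbR]
        nlinarith
      have h4 := mul_le_mul_of_nonneg_right h3 hCi.le
      have h5 := mul_le_mul_of_nonneg_right hη2s hCi.le
      nlinarith

lemma main_induct (K : ℕ) (hK : 2 ≤ K) :
    ∃ B D : ℝ, ∀ n : ℕ, 3 ≤ n → Odd n → ∀ (C μ : ℝ) (M : Multiset ℝ), 0 < C →
      InSupport K C μ n M →
      (n * (C ^ 2)⁻¹) * (1 / 4 * (Real.log (Real.log n) - D)) ≤ HM M ((n - 1) / 2) ∧
      HM M ((n - 1) / 2) ≤ (n * (C ^ 2)⁻¹) * (2080 * Real.log (Real.log n) + B) := by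
  obtain ⟨T, hTdef⟩ : ∃ T : ℕ, T = K ^ 10 + 400 ^ 4 := ⟨_, rfl⟩
  obtain ⟨B, hB0, hB⟩ := small_bound K hK T
  refine ⟨B, Real.log (Real.log T), ?_⟩
  have hlog3 : 1 ≤ Real.log 3 := by
    rw [Real.le_log_iff_exp_le (by norm_num)]
    linarith [Real.exp_one_lt_d9]
  intro n
  induction n using Nat.strong_induction_on with
  | _ n IH =>
  intro hn3 hodd C μ M hC h
  have hn3' : (3 : ℝ) ≤ n := by exact_mod_cast hn3
  have hlogn : 1 ≤ Real.log n := hlog3.trans (Real.log_le_log (by norm_num) hn3')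
  have hloglog : 0 ≤ Real.log (Real.log n) := Real.log_nonneg hlogn
  have hCi : 0 < (C ^ 2)⁻¹ := by positivity
  by_cases hT : n ≤ T
  · constructor
    · refine le_trans ?_ (HM_nonneg _ _)
      apply mul_nonpos_of_nonneg_of_nonpos (by positivity)
      have : Real.log (Real.log n) ≤ Real.log (Real.log T) := by
        apply Real.log_le_log (by linarith)
        apply Real.log_le_log (by linarith)
        exact_mod_cast hT
      linarith
    · refine (hB n hT hodd C μ M hC h).trans ?_
      have h1 : B ≤ n * (2080 * Real.log (Real.log n) + B) := by nlinarith
      have := mul_le_mul_of_nonneg_right h1 hCi.le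
      linarith
  · push Not at hT
    have hp : 0 < K ^ 10 := by positivity
    obtain ⟨η, s, C', μ', M', hηodd, hs, hsn, hs1, hs2, hC', hratio, hM', hlo, hhi⟩ :=
      step_main K hK C μ n M (by omega) (by omega) hodd hC h
    have hs0 : 0 < s := by linarith
    have hηn : η < n := by
      have : (η : ℝ) < n := by
        rw [← hsn]
        nlinarith [pow_le_pow_left₀ (by norm_num) hs 3]
      exact_mod_cast this
    have hη3 : 3 ≤ η := by
      have : (3 : ℝ) ≤ η := by linarith
      exact_mod_cast this
    obtain ⟨ilo, ihi⟩ := IH η hηn hη3 hηodd C' μ' M' hC' hM'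
    rw [hratio] at ilo ihi
    have hlogs : Real.log n = 4 * Real.log s := by
      rw [← hsn, Real.log_pow]; norm_num
    have hlη1 : Real.log n / 4 ≤ Real.log η := by
      rw [hlogs]
      have := Real.log_le_log hs0 hs1.le
      linarith
    have hlη2 : Real.log η ≤ Real.log n / 2 := by
      have : Real.log η ≤ Real.log (s ^ 2) :=
        Real.log_le_log (by linarith) (by nlinarith)
      rw [Real.log_pow] at this
      push_cast at this
      rw [hlogs]
      linarith
    have hll1 : Real.log (Real.log n) - Real.log 4 ≤ Real.log (Real.log η) := by
      rw [← Real.log_div (by linarith) (by norm_num)]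
      exact Real.log_le_log (by linarith) hlη1
    have hll2 : Real.log (Real.log η) ≤ Real.log (Real.log n) - Real.log 2 := by
      rw [← Real.log_div (by linarith) (by norm_num)]
      exact Real.log_le_log (by linarith) hlη2
    have hl2 := Real.log_two_gt_d9
    have hl2' := Real.log_two_lt_d9
    have hl4 : Real.log 4 = 2 * Real.log 2 := by
      rw [show (4 : ℝ) = 2 ^ 2 by norm_num, Real.log_pow]; norm_num
    have hX : 0 < n * (C ^ 2)⁻¹ := by positivity
    constructor
    · refine le_trans ?_ hlo
      have := mul_le_mul_of_nonneg_left (show 1 / 4 * (Real.log (Real.log n)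
        - Real.log (Real.log T)) ≤ 1 / 4 * (Real.log (Real.log η)
        - Real.log (Real.log T)) + 1 / 2 by linarith) hX.le
      linarith
    · refine hhi.trans ?_
      have := mul_le_mul_of_nonneg_left (show 2080 * Real.log (Real.log η) + B + 1040
        ≤ 2080 * Real.log (Real.log n) + B by linarith) hX.le
      linarith


theorem stmt11 :
    ∃ c₁ c₂ : ℝ, 0 < c₁ ∧ 0 < c₂ ∧
      ∀ K : ℕ, 2 ≤ K → ∃ N : ℕ, ∀ n : ℕ, N ≤ n → Odd n →
        ∀ C μ : ℝ, 0 < C → C < 1 / 4 →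
          ∀ M : Multiset ℝ, InSupport K C μ n M →
            c₁ * (C ^ 2)⁻¹ * n * Real.log (Real.exp 1 + Real.log n / Real.log K)
                ≤ HM M ((n - 1) / 2) ∧
              HM M ((n - 1) / 2)
                ≤ c₂ * (C ^ 2)⁻¹ * n * Real.log (Real.exp 1 + Real.log n / Real.log K) := by
  refine ⟨1 / 16, 4162, by norm_num, by norm_num, ?_⟩
  intro K hK
  obtain ⟨B, D, hmain⟩ := main_induct K hK
  have hK' : (2 : ℝ) ≤ K := by exact_mod_cast hK
  have hl2 := Real.log_two_gt_d9
  have hlK : Real.log 2 ≤ Real.log K := Real.log_le_log (by norm_num) hK'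
  have hlK0 : 0 < Real.log K := by linarith
  have hlim : Filter.Tendsto (fun n : ℕ => Real.log (Real.log (n : ℝ))) Filter.atTop
      Filter.atTop :=
    Real.tendsto_log_atTop.comp (Real.tendsto_log_atTop.comp tendsto_natCast_atTop_atTop)
  obtain ⟨N, hN⟩ := Filter.eventually_atTop.1 ((hlim.eventually_ge_atTop
    (|B| + 2 * |D| + 2 * |Real.log (Real.log K)| + 2 * Real.log 4 + 2)))
  refine ⟨N + 3, ?_⟩
  intro n hn hodd C μ hC _ M h
  have hL := hN n (by omega)
  obtain ⟨hlo, hhi⟩ := hmain n (by omega) hodd C μ M hC h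
  have hn3' : (3 : ℝ) ≤ n := by exact_mod_cast (by omega : 3 ≤ n)
  have hlogn : 1 ≤ Real.log n := by
    rw [Real.le_log_iff_exp_le (by linarith)]
    linarith [Real.exp_one_lt_d9]
  have hB := le_abs_self B
  have hD := le_abs_self D
  have hLK := le_abs_self (Real.log (Real.log K))
  have hB0 := abs_nonneg B
  have hD0 := abs_nonneg D
  have hLK0 := abs_nonneg (Real.log (Real.log K))
  have hl4 : 0 < Real.log 4 := Real.log_pos (by norm_num)
  have hq : 0 < Real.log n / Real.log K := by positivity
  have hup : Real.log (Real.exp 1 + Real.log n / Real.log K)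
      ≤ 2 * Real.log (Real.log n) := by
    have h1 : Real.log n / Real.log K ≤ 2 * Real.log n := by
      rw [div_le_iff₀ hlK0]; nlinarith
    have h2 : Real.log n ≥ 2 := by
      by_contra hlt
      push Not at hlt
      have : Real.log (Real.log n) ≤ Real.log n - 1 := Real.log_le_sub_one_of_pos (by linarith)
      linarith
    have h3 : Real.log (Real.exp 1 + Real.log n / Real.log K) ≤ Real.log (4 * Real.log n) := by
      apply Real.log_le_log (by positivity)
      linarith [Real.exp_one_lt_d9]
    rw [Real.log_mul (by norm_num) (by linarith)] at h3
    linarith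
  have hdn : Real.log (Real.log n) / 2
      ≤ Real.log (Real.exp 1 + Real.log n / Real.log K) := by
    have h1 : Real.log (Real.log n / Real.log K)
        ≤ Real.log (Real.exp 1 + Real.log n / Real.log K) := by
      apply Real.log_le_log hq
      linarith [Real.exp_pos 1]
    rw [Real.log_div (by linarith) (by linarith)] at h1
    linarith
  have hX : 0 < n * (C ^ 2)⁻¹ := by positivity
  constructor
  · refine le_trans ?_ hlo
    have := mul_le_mul_of_nonneg_left (show 1 / 16 * Real.log (Real.exp 1 + Real.log n / Real.log K)
      ≤ 1 / 4 * (Real.log (Real.log n) - D) by linarith) hX.le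
    linarith
  · refine hhi.trans ?_
    have := mul_le_mul_of_nonneg_left (show 2080 * Real.log (Real.log n) + B
      ≤ 4162 * Real.log (Real.exp 1 + Real.log n / Real.log K) by linarith) hX.le
    linarith
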